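/- arXiv:1512.02078 — 5 statements merged into one kernel-verified Lean document; each statement's English description precedes it below -/
import Mathlib

section
/- Given an epistemic model M w.r.t. a game structure G, the run model F⊗(M) generated by repeatedly updating U is a normal epistemic temporal model w.r.t. U. -/
namespace GameRuns

/-- An observation model: an equivalence relation on actions for each player. -/
structure ObsModel (I A : Type) where
  rel : I → A → A → Prop
  equiv : ∀ i, Equivalence (rel i)

/-- The data of a game structure: a partial transition function and game information. -/
structure GameData (I A P S : Type) where
  R : S → A → Option S
  O : S → I → Set P

/-- `G` is a game structure w.r.t. the player assignment `pl` and the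
distinguished information pieces `pa`. -/
def IsGameStructure {I A P S : Type} (pl : A → I) (pa : A → P) (G : GameData I A P S) : Prop :=
  Nonempty S ∧
  (∀ s a b, (G.R s a).isSome → (G.R s b).isSome → pl a = pl b) ∧
  (∀ s a, pa a ∈ G.O s (pl a) ↔ (G.R s a).isSome)

/-- The data of an epistemic model w.r.t. a game structure over states `S`. -/
structure EpiData (I A P S : Type) (W : Type) where
  f : W → S
  sim : I → W → W → Prop
  V : W → I → Set P

/-- `M` is an epistemic model w.r.t. the game structure `G`. -/
def IsEpiModel {I A P S W : Type} (G : GameData I A P S) (M : EpiData I A P S W) : Prop :=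
  Nonempty W ∧
  (∀ i, Equivalence (M.sim i)) ∧
  (∀ i w v, M.sim i w v → G.O (M.f w) i = G.O (M.f v) i) ∧
  (∀ w i, M.V w i = G.O (M.f w) i)

variable {I A P S : Type}

/-- Carrier of the update product `M ⊗ U`. -/
abbrev UpdW (G : GameData I A P S) {W : Type} (M : EpiData I A P S W) : Type :=
  {x : W × A // (G.R (M.f x.1) x.2).isSome}

/-- The update product `M ⊗ U`. -/
def update (G : GameData I A P S) (U : ObsModel I A) {W : Type} (M : EpiData I A P S W) :
    EpiData I A P S (UpdW G M) where
  f x := (G.R (M.f x.val.1) x.val.2).get x.prop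
  sim i x y := M.sim i x.val.1 y.val.1 ∧ U.rel i x.val.2 y.val.2 ∧
    G.O ((G.R (M.f x.val.1) x.val.2).get x.prop) i =
      G.O ((G.R (M.f y.val.1) y.val.2).get y.prop) i
  V x i := G.O ((G.R (M.f x.val.1) x.val.2).get x.prop) i

/-- The data of an epistemic temporal model. -/
structure ETLData (I A P : Type) (W : Type) where
  sim : I → W → W → Prop
  trans : A → W → W → Prop
  V : W → I → Set P

/-- `N` is an epistemic temporal model: nonempty carrier, equivalence relations. -/
def IsETL {W : Type} (N : ETLData I A P W) : Prop :=
  Nonempty W ∧ ∀ i, Equivalence (N.sim i)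

/-- The set of actions available at a state of an epistemic temporal model. -/
def Act {W : Type} (N : ETLData I A P W) (s : W) : Set A := {a | ∃ t, N.trans a s t}

/-- Normality of an epistemic temporal model w.r.t. an observation model:
no miracles, perfect recall, determinism, exclusive turns, info and knowledge of
own information. -/
def Normal (pl : A → I) (pa : A → P) (U : ObsModel I A) {W : Type}
    (N : ETLData I A P W) : Prop :=
  (∀ i a b s s' t t', N.sim i s s' → N.trans a s' t' → N.trans b s t →
      U.rel i b a → N.V t i = N.V t' i → N.sim i t t') ∧
  (∀ i a s t t', N.trans a s t → N.sim i t t' →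
      ∃ s' b, N.sim i s s' ∧ U.rel i a b ∧ N.trans b s' t') ∧
  (∀ a s t t', N.trans a s t → N.trans a s t' → t = t') ∧
  (∀ s : W, (Act N s).Nonempty → ∃ j, ∀ a ∈ Act N s, pl a = j) ∧
  (∀ s a, pa a ∈ N.V s (pl a) ↔ ∃ t, N.trans a s t) ∧
  (∀ i w v, N.sim i w v → N.V w i = N.V v i)

/-- A bundled epistemic model (carrier together with the model). -/
structure BEpi (I A P S : Type) where
  W : Type
  M : EpiData I A P S W

/-- Bundled update. -/
def bUpdate (G : GameData I A P S) (U : ObsModel I A) (B : BEpi I A P S) : BEpi I A P S :=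
  ⟨UpdW G B.M, update G U B.M⟩

/-- Iterated update `M ⊗ U^k`. -/
def iter (G : GameData I A P S) (U : ObsModel I A) (B : BEpi I A P S) : ℕ → BEpi I A P S
  | 0 => B
  | k + 1 => bUpdate G U (iter G U B k)

/-- Carrier of the run model generated by repeatedly updating `U`:
states of level `k` are the states of `M ⊗ U^k`. -/
abbrev RunW (G : GameData I A P S) (U : ObsModel I A) (B : BEpi I A P S) : Type :=
  Σ k : ℕ, (iter G U B k).W

/-- The successor state `(w, a)` of `w` in the next level of the run model. -/
def stepUp (G : GameData I A P S) (U : ObsModel I A) (B : BEpi I A P S) (k : ℕ)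
    (w : (iter G U B k).W) (a : A) (h : (G.R ((iter G U B k).M.f w) a).isSome) :
    (iter G U B (k + 1)).W :=
  ⟨(w, a), h⟩

/-- Epistemic relation of the run model. -/
def runSim (G : GameData I A P S) (U : ObsModel I A) (B : BEpi I A P S) (i : I) :
    RunW G U B → RunW G U B → Prop := fun x y =>
  ∃ h : x.1 = y.1,
    (iter G U B y.1).M.sim i (cast (congrArg (fun k => (iter G U B k).W) h) x.2) y.2

/-- Action relation of the run model. -/
def runTrans (G : GameData I A P S) (U : ObsModel I A) (B : BEpi I A P S) (a : A) :
    RunW G U B → RunW G U B → Prop := fun x y =>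
  ∃ h : (G.R ((iter G U B x.1).M.f x.2) a).isSome,
    y = ⟨x.1 + 1, stepUp G U B x.1 x.2 a h⟩

/-- The run model `F⊗(M)` generated by repeatedly updating `U`. -/
def runModel (G : GameData I A P S) (U : ObsModel I A) (B : BEpi I A P S) :
    ETLData I A P (RunW G U B) where
  sim := runSim G U B
  trans := runTrans G U B
  V x i := (iter G U B x.1).M.V x.2 i

/-- The induced state assignment function of the run model. -/
def runF (G : GameData I A P S) (U : ObsModel I A) (B : BEpi I A P S) :
    RunW G U B → S := fun x => (iter G U B x.1).M.f x.2



section More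
variable {I A P S : Type}

/-- The state reached by following a list of actions from `s`, if it exists. -/
def runPath (G : GameData I A P S) : S → List A → Option S
  | s, [] => some s
  | s, a :: l => (G.R s a).bind fun t => runPath G t l

theorem runPath_append (G : GameData I A P S) (s : S) (l : List A) (a : A) :
    runPath G s (l ++ [a]) = (runPath G s l).bind fun t => G.R t a := by
  induction l generalizing s with
  | nil => simp [runPath]
  | cons b l ih =>
    simp only [List.cons_append, runPath]
    cases h : G.R s b with
    | none => simp
    | some t => simp [ih]

/-- The initial world and the sequence of actions of a state of the run model. -/
def runActs (G : GameData I A P S) (U : ObsModel I A) (B : BEpi I A P S) :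
    (k : ℕ) → (iter G U B k).W → B.W × List A
  | 0, w => (w, [])
  | k + 1, w =>
      ((runActs G U B k w.val.1).1, (runActs G U B k w.val.1).2 ++ [w.val.2])

theorem runActs_path (G : GameData I A P S) (U : ObsModel I A) (B : BEpi I A P S) :
    ∀ (k : ℕ) (w : (iter G U B k).W),
      runPath G (B.M.f (runActs G U B k w).1) (runActs G U B k w).2 =
        some ((iter G U B k).M.f w) := by
  intro k
  induction k with
  | zero => intro w; rfl
  | succ k ih =>
    intro w
    have h1 := ih w.val.1
    show runPath G _ _ = some ((update G U (iter G U B k).M).f w)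
    rw [show runActs G U B (k + 1) w =
        ((runActs G U B k w.val.1).1, (runActs G U B k w.val.1).2 ++ [w.val.2]) from rfl]
    rw [runPath_append, h1]
    exact (Option.some_get w.prop).symm

/-- Carrier of the epistemic game tree generatedfrom `s`: valid histories. -/
abbrev TreeW (G : GameData I A P S) (s : S) : Type := {l : List A // (runPath G s l).isSome}

/-- The epistemic game tree generated from `s` with perfect recall,
viewed as an epistemic temporal model. -/
def tree (G : GameData I A P S) (s : S) : ETLData I A P (TreeW G s) where
  sim i w u := w.val.length = u.val.length ∧
    ∀ k, (runPath G s (w.val.take k)).map (fun t => G.O t i) =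
      (runPath G s (u.val.take k)).map (fun t => G.O t i)
  trans a w u := u.val = w.val ++ [a]
  V w i := G.O ((runPath G s w.val).get w.prop) i

/-- The tracking function from the run model of a certainty epistemic model to the
epistemic game tree generated from the (common-knowledge) initial state. -/
def tracking (G : GameData I A P S) (U : ObsModel I A) {W : Type} (M : EpiData I A P S W)
    (v : W) (hv : ∀ x : W, x = v) (x : RunW G U ⟨W, M⟩) : TreeW G (M.f v) :=
  ⟨(runActs G U ⟨W, M⟩ x.1 x.2).2, by
    have h : runPath G (M.f (runActs G U ⟨W, M⟩ x.1 x.2).1)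
        (runActs G U ⟨W, M⟩ x.1 x.2).2 = some ((iter G U ⟨W, M⟩ x.1).M.f x.2) :=
      runActs_path G U ⟨W, M⟩ x.1 x.2
    rw [hv (runActs G U ⟨W, M⟩ x.1 x.2).1] at h
    rw [h]
    rfl⟩

/-- `U` is non-informative w.r.t. an epistemic temporal model. -/
def NonInformative (U : ObsModel I A) {W : Type} (N : ETLData I A P W) : Prop :=
  ∀ i a b w u s t, N.trans a w s → N.trans b u t → N.sim i w u →
    ¬ U.rel i a b → N.V s i ≠ N.V t i

/-- Isomorphism of epistemic temporal models. -/
def IsIso {W W' : Type} (N : ETLData I A P W) (N' : ETLData I A P W') (g : W → W') : Prop :=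
  Function.Bijective g ∧
  (∀ i x y, N.sim i x y ↔ N'.sim i (g x) (g y)) ∧
  (∀ a x y, N.trans a x y ↔ N'.trans a (g x) (g y)) ∧
  (∀ x i, N.V x i = N'.V (g x) i)

/-- p-morphisms between epistemic temporal models. -/
def IsPMorphism {W W' : Type} (N : ETLData I A P W) (N' : ETLData I A P W')
    (g : W → W') : Prop :=
  (∀ w i, N.V w i = N'.V (g w) i) ∧
  (∀ i w u, N.sim i w u → N'.sim i (g w) (g u)) ∧
  (∀ i w s, N'.sim i (g w) s → ∃ v, g v = s ∧ N.sim i w v) ∧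
  (∀ a w u, N.trans a w u → N'.trans a (g w) (g u)) ∧
  (∀ a w s, N'.trans a (g w) s → ∃ v, g v = s ∧ N.trans a w v)

/-- The induced epistemic game structure `E(G)`, viewed as an epistemic temporal model. -/
def egame (G : GameData I A P S) : ETLData I A P S where
  sim i s t := G.O s i = G.O t i
  trans a s t := G.R s a = some t
  V s i := G.O s i

/-- `G` is a perfect information game: the induced epistemic relations are the identity. -/
def PerfectInfo (G : GameData I A P S) : Prop :=
  ∀ i s t, G.O s i = G.O t i → s = t

/-- The game induced by an epistemic temporal model: `R(s,a) = t` iff `s →_a t`. -/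
noncomputable def inducedGame {W : Type} (N : ETLData I A P W) : GameData I A P W where
  R s a := @dite _ (∃ t, N.trans a s t) (Classical.propDecidable _)
    (fun h => some h.choose) (fun _ => none)
  O := N.V

/-- The epistemic part induced by an epistemic temporal model. -/
def epiPart {W : Type} (N : ETLData I A P W) : EpiData I A P W W where
  f := id
  sim := N.sim
  V := N.V

theorem inducedGame_isSome {W : Type} (N : ETLData I A P W) {a : A} {s t : W}
    (h : N.trans a s t) : ((inducedGame N).R s a).isSome := by
  show (@dite _ (∃ t, N.trans a s t) (Classical.propDecidable _)
    (fun h => some h.choose) (fun _ => none)).isSome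
  rw [dif_pos ⟨t, h⟩]
  rfl

end More
section Lang
variable {I A P S : Type}

/-- The dynamic epistemic language LDEL. -/
inductive LDEL (I A P : Type) : Type where
  | top : LDEL I A P
  | atom : P → I → LDEL I A P
  | neg : LDEL I A P → LDEL I A P
  | conj : LDEL I A P → LDEL I A P → LDEL I A P
  | know : I → LDEL I A P → LDEL I A P
  | box : A → LDEL I A P → LDEL I A P

/-- Implication, defined from negation and conjunction. -/
def impF (φ ψ : LDEL I A P) : LDEL I A P := .neg (.conj φ (.neg ψ))

/-- Disjunction. -/
def orF (φ ψ : LDEL I A P) : LDEL I A P := .neg (.conj (.neg φ) (.neg ψ))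

/-- Biconditional. -/
def iffF (φ ψ : LDEL I A P) : LDEL I A P := .conj (impF φ ψ) (impF ψ φ)

/-- Diamond `⟨a⟩φ`. -/
def diaF (a : A) (φ : LDEL I A P) : LDEL I A P := .neg (.box a (.neg φ))

/-- The dual knowledge modality `K̂_i φ`. -/
def khatF (i : I) (φ : LDEL I A P) : LDEL I A P := .neg (.know i (.neg φ))

/-- Finite conjunction. -/
def bigAnd : List (LDEL I A P) → LDEL I A P
  | [] => .top
  | φ :: l => .conj φ (bigAnd l)

/-- Finite disjunction. -/
def bigOr : List (LDEL I A P) → LDEL I A P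
  | [] => .neg .top
  | φ :: l => orF φ (bigOr l)

/-- The characteristic formula `φ^o_i` of a combination of information pieces,
where `L1` enumerates the pieces in `B` and `L2` those not in `B`. -/
def charF (i : I) (L1 L2 : List P) : LDEL I A P :=
  .conj (bigAnd (L1.map (fun p => LDEL.atom p i)))
    (bigAnd (L2.map (fun p => LDEL.neg (LDEL.atom p i))))

/-- `TURN_i`, given an enumeration `l` of the actions of player `i`. -/
def turnF (l : List A) : LDEL I A P := bigOr (l.map (fun a => diaF a LDEL.top))

/-- Propositional evaluation treating atoms, `K_i ψ` and `[a]ψ` as atomic. -/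
def propEval (v : LDEL I A P → Prop) : LDEL I A P → Prop
  | .top => True
  | .neg φ => ¬ propEval v φ
  | .conj φ ψ => propEval v φ ∧ propEval v ψ
  | φ => v φ

/-- The dynamic (DEL-style) semantics `⊨` over epistemic models w.r.t. a game structure. -/
def dynSat (G : GameData I A P S) (U : ObsModel I A) :
    LDEL I A P → (W : Type) → EpiData I A P S W → W → Prop
  | .top, _, _, _ => True
  | .atom p i, _, M, w => p ∈ M.V w i
  | .neg φ, W, M, w => ¬ dynSat G U φ W M w
  | .conj φ ψ, W, M, w => dynSat G U φ W M w ∧ dynSat G U ψ W M w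
  | .know i φ, W, M, w => ∀ v, M.sim i w v → dynSat G U φ W M v
  | .box a φ, _, M, w => ∀ h : (G.R (M.f w) a).isSome,
      dynSat G U φ (UpdW G M) (update G U M) ⟨(w, a), h⟩

/-- The epistemic temporal (ETL-style) semantics `⊩`. -/
def etlSat {W : Type} (N : ETLData I A P W) : LDEL I A P → W → Prop
  | .top, _ => True
  | .atom p i, w => p ∈ N.V w i
  | .neg φ, w => ¬ etlSat N φ w
  | .conj φ ψ, w => etlSat N φ w ∧ etlSat N ψ w
  | .know i φ, w => ∀ v, N.sim i w v → etlSat N φ v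
  | .box a φ, w => ∀ v, N.trans a w v → etlSat N φ v

/-- `Z` is a `G`-bisimulation between two epistemic models w.r.t. `G`. -/
def IsGBisim {W W' : Type} (G : GameData I A P S) (M : EpiData I A P S W)
    (N : EpiData I A P S W') (Z : W → W' → Prop) : Prop :=
  ∀ w u, Z w u →
    M.f w = N.f u ∧
    (∀ i w', M.sim i w w' → ∃ u', N.sim i u u' ∧ Z w' u') ∧
    (∀ i u', N.sim i u u' → ∃ w', M.sim i w w' ∧ Z w' u')

/-- Pointed `G`-bisimilarity. -/
def GBisimilar {W W' : Type} (G : GameData I A P S) (M : EpiData I A P S W)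
    (N : EpiData I A P S W') (w : W) (u : W') : Prop :=
  ∃ Z, IsGBisim G M N Z ∧ Z w u

/-- The proof system SIG. -/
inductive SIG (pl : A → I) (pa : A → P) (U : ObsModel I A) : LDEL I A P → Prop where
  | taut {φ : LDEL I A P} : (∀ v, propEval v φ) → SIG pl pa U φ
  | distK (i : I) (φ ψ : LDEL I A P) :
      SIG pl pa U (impF (.know i (impF φ ψ)) (impF (.know i φ) (.know i ψ)))
  | distB (a : A) (φ ψ : LDEL I A P) :
      SIG pl pa U (impF (.box a (impF φ ψ)) (impF (.box a φ) (.box a ψ)))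
  | axT (i : I) (φ : LDEL I A P) : SIG pl pa U (impF (.know i φ) φ)
  | ax4 (i : I) (φ : LDEL I A P) :
      SIG pl pa U (impF (.know i φ) (.know i (.know i φ)))
  | ax5 (i : I) (φ : LDEL I A P) :
      SIG pl pa U (impF (.neg (.know i φ)) (.know i (.neg (.know i φ))))
  | nm (i : I) (a b : A) (φ : LDEL I A P) (B : Set P) (L1 L2 : List P)
      (h1 : ∀ p, p ∈ L1 ↔ p ∈ B) (h2 : ∀ p, p ∈ L2 ↔ p ∉ B) (hab : U.rel i a b) :
      SIG pl pa U (impF (khatF i (diaF b (.conj φ (charF i L1 L2))))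
        (.box a (impF (charF i L1 L2) (khatF i φ))))
  | pr (i : I) (a : A) (φ : LDEL I A P) (L : List A) (hL : ∀ b, b ∈ L ↔ U.rel i a b) :
      SIG pl pa U (impF (diaF a (khatF i φ))
        (bigOr (L.map (fun b => khatF i (diaF b φ)))))
  | det (a : A) (φ : LDEL I A P) : SIG pl pa U (impF (diaF a φ) (.box a φ))
  | exturn (i : I) (LA : I → List A) (hLA : ∀ j a, a ∈ LA j ↔ pl a = j)
      (LI : List I) (hLI : ∀ j, j ∈ LI ↔ j ≠ i) :
      SIG pl pa U (impF (turnF (LA i))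
        (bigAnd (LI.map (fun j => LDEL.neg (turnF (LA j))))))
  | info (a : A) : SIG pl pa U (iffF (diaF a .top) (.atom (pa a) (pl a)))
  | ke (p : P) (i : I) :
      SIG pl pa U (.conj (impF (.atom p i) (.know i (.atom p i)))
        (impF (.neg (.atom p i)) (.know i (.neg (.atom p i)))))
  | mp {φ ψ : LDEL I A P} : SIG pl pa U (impF φ ψ) → SIG pl pa U φ → SIG pl pa U ψ
  | necK (i : I) {φ : LDEL I A P} : SIG pl pa U φ → SIG pl pa U (.know i φ)
  | necB (a : A) {φ : LDEL I A P} : SIG pl pa U φ → SIG pl pa U (.box a φ)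

/-- A set of formulas is SIG-inconsistent if the negation of the conjunction of some
finite list of its members is derivable. -/
def Inconsistent (pl : A → I) (pa : A → P) (U : ObsModel I A)
    (Γ : Set (LDEL I A P)) : Prop :=
  ∃ L : List (LDEL I A P), (∀ φ ∈ L, φ ∈ Γ) ∧ SIG pl pa U (.neg (bigAnd L))

/-- Maximally SIG-consistent sets. -/
def MCS (pl : A → I) (pa : A → P) (U : ObsModel I A) (Γ : Set (LDEL I A P)) : Prop :=
  ¬ Inconsistent pl pa U Γ ∧ ∀ Δ, Γ ⊂ Δ → Inconsistent pl pa U Δ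

/-- Carrier of the canonical model: all maximally consistent sets. -/
abbrev CanW (pl : A → I) (pa : A → P) (U : ObsModel I A) : Type :=
  {Γ : Set (LDEL I A P) // MCS pl pa U Γ}

/-- The canonical model of SIG. -/
def canonical (pl : A → I) (pa : A → P) (U : ObsModel I A) :
    ETLData I A P (CanW pl pa U) where
  sim i w u := ∀ φ, LDEL.know i φ ∈ w.val → φ ∈ u.val
  trans a w u := ∀ φ, LDEL.box a φ ∈ w.val → φ ∈ u.val
  V w i := {p | LDEL.atom p i ∈ w.val}

end Lang

section RunModel
variable {I A P S : Type}

theorem iter_V (G : GameData I A P S) (U : ObsModel I A) (B : BEpi I A P S)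
    (hV : ∀ w i, B.M.V w i = G.O (B.M.f w) i) (k : ℕ) (w : (iter G U B k).W) (i : I) :
    (iter G U B k).M.V w i = G.O ((iter G U B k).M.f w) i := by
  cases k with
  | zero => exact hV w i
  | succ k => rfl

theorem iter_sim_info (G : GameData I A P S) (U : ObsModel I A) (B : BEpi I A P S) (i : I)
    (hO : ∀ w v, B.M.sim i w v → G.O (B.M.f w) i = G.O (B.M.f v) i) (k : ℕ)
    (w v : (iter G U B k).W) (h : (iter G U B k).M.sim i w v) :
    G.O ((iter G U B k).M.f w) i = G.O ((iter G U B k).M.f v) i := by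
  cases k with
  | zero => exact hO w v h
  | succ k => exact h.2.2

theorem update_sim_equivalence (G : GameData I A P S) (U : ObsModel I A) {W : Type}
    (M : EpiData I A P S W) (i : I) (h : Equivalence (M.sim i)) :
    Equivalence ((update G U M).sim i) where
  refl _ := ⟨h.refl _, (U.equiv i).refl _, rfl⟩
  symm := fun ⟨h₁, h₂, h₃⟩ => ⟨h.symm h₁, (U.equiv i).symm h₂, h₃.symm⟩
  trans := fun ⟨h₁, h₂, h₃⟩ ⟨k₁, k₂, k₃⟩ =>
    ⟨h.trans h₁ k₁, (U.equiv i).trans h₂ k₂, h₃.trans k₃⟩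

theorem iter_sim_equivalence (G : GameData I A P S) (U : ObsModel I A) (B : BEpi I A P S) (i : I)
    (h : Equivalence (B.M.sim i)) (k : ℕ) : Equivalence ((iter G U B k).M.sim i) := by
  induction k with
  | zero => exact h
  | succ k ih => exact update_sim_equivalence G U _ i ih

theorem runSim_equivalence (G : GameData I A P S) (U : ObsModel I A) (B : BEpi I A P S) (i : I)
    (h : Equivalence (B.M.sim i)) : Equivalence (runSim G U B i) where
  refl _ := ⟨rfl, (iter_sim_equivalence G U B i h _).refl _⟩
  symm := by
    rintro ⟨k, w⟩ ⟨l, v⟩ ⟨hkl, hs⟩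
    obtain rfl : k = l := hkl
    exact ⟨rfl, (iter_sim_equivalence G U B i h k).symm hs⟩
  trans := by
    rintro ⟨k, w⟩ ⟨l, v⟩ ⟨m, u⟩ ⟨hkl, hs⟩ ⟨hlm, ht⟩
    obtain rfl : k = l := hkl
    obtain rfl : k = m := hlm
    exact ⟨rfl, (iter_sim_equivalence G U B i h k).trans hs ht⟩

end RunModel

section Statements
variable {I A P S W W' : Type}

theorem statement2 [Fintype I] [Fintype A] [Fintype P] [Nonempty I] [Nonempty A]
    (pl : A → I) (pa : A → P) (U : ObsModel I A)
    (G : GameData I A P S) (hG : IsGameStructure pl pa G)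
    (M : EpiData I A P S W) (hM : IsEpiModel G M) :
    IsETL (runModel G U ⟨W, M⟩) ∧ Normal pl pa U (runModel G U ⟨W, M⟩) := by
  obtain ⟨⟨w₀⟩, hEq, hO, hV⟩ := hM
  obtain ⟨-, hTurn, hInfo⟩ := hG
  refine ⟨⟨⟨⟨0, w₀⟩⟩, fun i => runSim_equivalence G U ⟨W, M⟩ i (hEq i)⟩,
    ?_, ?_, ?_, ?_, ?_, ?_⟩
  · rintro i a b ⟨k, w⟩ ⟨l, v⟩ t t' ⟨hkl, hs⟩ ⟨ha, rfl⟩ ⟨hb, rfl⟩ hba hVt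
    obtain rfl : k = l := hkl
    exact ⟨rfl, hs, hba, hVt⟩
  · rintro i a ⟨k, w⟩ t ⟨l, v⟩ ⟨ha, rfl⟩ ⟨hkl, hs⟩
    obtain rfl : k + 1 = l := hkl
    exact ⟨⟨k, v.val.1⟩, v.val.2, ⟨rfl, hs.1⟩, hs.2.1, v.prop, rfl⟩
  · rintro a s t t' ⟨_, rfl⟩ ⟨_, rfl⟩
    rfl
  · rintro s ⟨a, t, ha, -⟩
    exact ⟨pl a, fun b ⟨_, hb, _⟩ => hTurn _ b a hb ha⟩
  · intro s a
    have hs : (runModel G U ⟨W, M⟩).V s (pl a) = G.O (runF G U ⟨W, M⟩ s) (pl a) :=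
      iter_V G U ⟨W, M⟩ hV s.1 s.2 (pl a)
    rw [hs, hInfo]
    exact ⟨fun h => ⟨_, h, rfl⟩, fun ⟨_, h, _⟩ => h⟩
  · rintro i ⟨k, w⟩ ⟨l, v⟩ ⟨hkl, hs⟩
    obtain rfl : k = l := hkl
    exact (iter_V G U ⟨W, M⟩ hV k w i).trans
      ((iter_sim_info G U ⟨W, M⟩ i (hO i) k w v hs).trans (iter_V G U ⟨W, M⟩ hV k v i).symm)

end Statements
end GameRuns
end

section
/- Let N = (W, ∼, →, V) be a normal epistemic temporal model w.r.t. U, let G = G_N be the game induced by N and let M = M_N be the epistemic part induced by N. Then for all s, t ∈ W and a ∈ A: s →_a t implies that the pointed models M ⊗ U, (s,a) and M, t are G-bisimilar. -/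
namespace GameRuns

variable {I A P S : Type}

section Statements
variable {I A P S W W' : Type}

/-- Every defined transition of the induced game is a transition of the model. -/
theorem inducedGame_trans_get {I A P W : Type} (N : ETLData I A P W) {a : A} {s : W}
    (h : ((inducedGame N).R s a).isSome) : N.trans a s (((inducedGame N).R s a).get h) := by
  by_cases hex : ∃ t, N.trans a s t
  · have hR : (inducedGame N).R s a = some hex.choose := dif_pos hex
    simpa only [hR, Option.get_some] using hex.choose_spec
  · have hR : (inducedGame N).R s a = none := dif_neg hex
    simp [hR] at h

theorem statement9 [Fintype I] [Fintype A] [Fintype P] [Nonempty I] [Nonempty A]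
    (pl : A → I) (pa : A → P) (U : ObsModel I A)
    (N : ETLData I A P W) (hetl : IsETL N) (hn : Normal pl pa U N)
    (s t : W) (a : A) (h : N.trans a s t) :
    GBisimilar (inducedGame N) (update (inducedGame N) U (epiPart N)) (epiPart N)
      ⟨(s, a), inducedGame_isSome N h⟩ t := by
  obtain ⟨nm, pr, det, -, -, ke⟩ := hn
  refine ⟨fun x u => N.trans x.val.2 x.val.1 u, fun x u hxu => ⟨?_, ?_, ?_⟩, h⟩
  · exact det _ _ _ _ (inducedGame_trans_get N x.prop) hxu
  · rintro i y ⟨hsim, hrel, hO⟩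
    have hx := inducedGame_trans_get N x.prop
    have hy := inducedGame_trans_get N y.prop
    refine ⟨_, nm i _ _ _ _ _ _ hsim hy hxu hrel ?_, hy⟩
    rw [det _ _ _ _ hxu hx]
    exact hO
  · intro i u' hu
    obtain ⟨s', b, hs, hab, hb⟩ := pr i _ _ _ _ hxu hu
    refine ⟨⟨(s', b), inducedGame_isSome N hb⟩, ⟨hs, hab, ?_⟩, hb⟩
    have hx := det _ _ _ _ (inducedGame_trans_get N x.prop) hxu
    have hy := det _ _ _ _ (inducedGame_trans_get N (inducedGame_isSome N hb)) hb
    exact (congrArg (N.V · i) hx).trans ((ke i _ _ hu).trans (congrArg (N.V · i) hy).symm)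

end Statements
end GameRuns
end

section
/- Let G be a game structure, M = (W, f, ∼, V) an epistemic model w.r.t. G and F⊗(M) the run model generated by repeatedly updating U. Then for every LDEL formula φ and every w ∈ W: M, w ⊨ φ if and only if F⊗(M), (w) ⊩ φ, where (w) denotes the length-0 tuple of w in the run model. -/
namespace GameRuns

variable {I A P S : Type}

section Statements
variable {I A P S W W' : Type}

/-- At every level `k`, the dynamic semantics on `M ⊗ U^k` agrees with the temporal semantics
on the run model. -/
theorem dynSat_iter_iff_etlSat_runModel (G : GameData I A P S) (U : ObsModel I A)
    (B : BEpi I A P S) (φ : LDEL I A P) (k : ℕ) (w : (iter G U B k).W) :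
    dynSat G U φ (iter G U B k).W (iter G U B k).M w ↔ etlSat (runModel G U B) φ ⟨k, w⟩ := by
  induction φ generalizing k with
  | top => exact Iff.rfl
  | atom p i => exact Iff.rfl
  | neg φ ih => exact not_congr (ih k w)
  | conj φ ψ ihφ ihψ => exact and_congr (ihφ k w) (ihψ k w)
  | know i φ ih =>
    constructor
    · rintro h ⟨j, v⟩ ⟨hj, hv⟩
      obtain rfl : k = j := hj
      exact (ih k v).1 (h v hv)
    · intro h v hv
      exact (ih k v).2 (h ⟨k, v⟩ ⟨rfl, hv⟩)
  | box a φ ih =>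
    constructor
    · rintro h v ⟨ha, rfl⟩
      exact (ih (k + 1) (stepUp G U B k w a ha)).1 (h ha)
    · intro h ha
      exact (ih (k + 1) (stepUp G U B k w a ha)).2 (h _ ⟨ha, rfl⟩)

theorem statement11 [Fintype I] [Fintype A] [Fintype P] [Nonempty I] [Nonempty A]
    (pl : A → I) (pa : A → P) (U : ObsModel I A)
    (G : GameData I A P S) (hG : IsGameStructure pl pa G)
    (M : EpiData I A P S W) (hM : IsEpiModel G M)
    (φ : LDEL I A P) (w : W) :
    dynSat G U φ W M w ↔ etlSat (runModel G U ⟨W, M⟩) φ ⟨0, w⟩ :=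
  dynSat_iter_iff_etlSat_runModel G U ⟨W, M⟩ φ 0 w

end Statements
end GameRuns
end

section
/- For every LDEL formula φ: φ holds at every world of every epistemic model with respect to every game structure (under the dynamic semantics ⊨) if and only if φ holds at every world of every normal epistemic temporal model with respect to U (under the ETL semantics ⊩). -/
namespace GameRuns

variable {I A P S : Type}

section Statements
variable {I A P S W W' : Type}

/-- The state component of the update product of the game induced by a deterministic model
follows the transitions of the model. -/
theorem inducedGame_get_eq {N : ETLData I A P W}
    (hdet : ∀ a s t t', N.trans a s t → N.trans a s t' → t = t')
    {a : A} {s t : W} (h : N.trans a s t) (hs : ((inducedGame N).R s a).isSome) :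
    ((inducedGame N).R s a).get hs = t := by
  have hex : ∃ t, N.trans a s t := ⟨t, h⟩
  have hR : (inducedGame N).R s a = some hex.choose := dif_pos hex
  simp only [hR, Option.get_some]
  exact hdet a s _ _ hex.choose_spec h

theorem inducedGame_exists_trans {N : ETLData I A P W} {a : A} {s : W}
    (hs : ((inducedGame N).R s a).isSome) : ∃ t, N.trans a s t := by
  by_contra hn
  have hR : (inducedGame N).R s a = none := dif_neg hn
  simp [hR] at hs

theorem inducedGame_isGameStructure {pl : A → I} {pa : A → P} {U : ObsModel I A}
    {N : ETLData I A P W} (hE : IsETL N) (hN : Normal pl pa U N) :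
    IsGameStructure pl pa (inducedGame N) := by
  obtain ⟨-, -, -, hturn, hinfo, -⟩ := hN
  refine ⟨hE.1, fun s a b ha hb => ?_, fun s a => (hinfo s a).trans
    ⟨fun ⟨_, h⟩ => inducedGame_isSome N h, inducedGame_exists_trans⟩⟩
  have ha := inducedGame_exists_trans ha
  obtain ⟨j, hj⟩ := hturn s ⟨a, ha⟩
  exact (hj a ha).trans (hj b (inducedGame_exists_trans hb)).symm

/-- If the state assignment of an epistemic model w.r.t. the game induced by a normal model `N`
is a p-morphism onto its image for the epistemic relations of `N`, then it preserves truth. -/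
theorem dynSat_inducedGame_iff {pl : A → I} {pa : A → P} {U : ObsModel I A}
    {N : ETLData I A P W} (hN : Normal pl pa U N) (φ : LDEL I A P) :
    ∀ (X : Type) (M : EpiData I A P W X),
      (∀ i w v, M.sim i w v → N.sim i (M.f w) (M.f v)) →
      (∀ i w s, N.sim i (M.f w) s → ∃ v, M.f v = s ∧ M.sim i w v) →
      (∀ w i, M.V w i = N.V (M.f w) i) →
      ∀ w, dynSat (inducedGame N) U φ X M w ↔ etlSat N φ (M.f w) := by
  obtain ⟨hnm, hpr, hdet, -, -, hke⟩ := hN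
  induction φ with
  | top => exact fun _ _ _ _ _ _ => Iff.rfl
  | atom p i =>
    intro X M _ _ hV w
    simp only [dynSat, etlSat, hV]
  | neg φ ih => exact fun X M hf hb hV w => not_congr (ih X M hf hb hV w)
  | conj φ ψ ih₁ ih₂ =>
    exact fun X M hf hb hV w => and_congr (ih₁ X M hf hb hV w) (ih₂ X M hf hb hV w)
  | know i φ ih =>
    intro X M hf hb hV w
    constructor
    · intro h s hs
      obtain ⟨v, rfl, hv⟩ := hb i w s hs
      exact (ih X M hf hb hV v).1 (h v hv)
    · exact fun h v hv => (ih X M hf hb hV v).2 (h _ (hf i w v hv))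
  | box a φ ih =>
    intro X M hf hb hV w
    have htrans : ∀ x : UpdW (inducedGame N) M,
        N.trans x.val.2 (M.f x.val.1) ((update (inducedGame N) U M).f x) := by
      intro x
      obtain ⟨t, ht⟩ := inducedGame_exists_trans x.prop
      have hx : (update (inducedGame N) U M).f x = t := inducedGame_get_eq hdet ht x.prop
      rwa [hx]
    have key := ih _ (update (inducedGame N) U M)
      (fun i x y hxy => hnm i _ _ _ _ _ _ (hf i _ _ hxy.1) (htrans y) (htrans x)
        hxy.2.1 hxy.2.2)
      (fun i x t ht => by
        obtain ⟨s', b, hs', hab, hst⟩ := hpr i _ _ _ _ (htrans x) ht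
        obtain ⟨v, rfl, hv⟩ := hb i _ _ hs'
        have hsome := inducedGame_isSome N hst
        have hget := inducedGame_get_eq hdet hst hsome
        refine ⟨⟨(v, b), hsome⟩, hget, hv, hab, ?_⟩
        exact (hke i _ _ ht).trans (congrArg (fun u => N.V u i) hget.symm))
      (fun _ _ => rfl)
    constructor
    · intro h t ht
      have hsome := inducedGame_isSome N ht
      have := (key ⟨(w, a), hsome⟩).1 (h hsome)
      rwa [show (update (inducedGame N) U M).f ⟨(w, a), hsome⟩ = t from
        inducedGame_get_eq hdet ht hsome] at this
    · exact fun h hs => (key ⟨(w, a), hs⟩).2 (h _ (htrans ⟨(w, a), hs⟩))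

/-- All levels of the run model inherit the laws of epistemic models, except nonemptiness. -/
theorem iter_laws (G : GameData I A P S) (U : ObsModel I A) (B : BEpi I A P S)
    (hB : IsEpiModel G B.M) (k : ℕ) :
    (∀ i, Equivalence ((iter G U B k).M.sim i)) ∧
    (∀ i w v, (iter G U B k).M.sim i w v →
      G.O ((iter G U B k).M.f w) i = G.O ((iter G U B k).M.f v) i) ∧
    (∀ w i, (iter G U B k).M.V w i = G.O ((iter G U B k).M.f w) i) := by
  induction k with
  | zero => exact hB.2
  | succ k ih =>
    obtain ⟨hsim, -, -⟩ := ih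
    refine ⟨fun i => ⟨fun x => ⟨(hsim i).refl _, (U.equiv i).refl _, rfl⟩,
      fun h => ⟨(hsim i).symm h.1, (U.equiv i).symm h.2.1, h.2.2.symm⟩,
      fun h h' => ⟨(hsim i).trans h.1 h'.1, (U.equiv i).trans h.2.1 h'.2.1,
        h.2.2.trans h'.2.2⟩⟩, fun i w v h => h.2.2, fun _ _ => rfl⟩

theorem runModel_isETL (G : GameData I A P S) (U : ObsModel I A) (B : BEpi I A P S)
    (hB : IsEpiModel G B.M) : IsETL (runModel G U B) := by
  obtain ⟨w⟩ := hB.1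
  refine ⟨⟨⟨0, w⟩⟩, fun i => ⟨?_, ?_, ?_⟩⟩
  · rintro ⟨k, x⟩
    exact ⟨rfl, ((iter_laws G U B hB k).1 i).refl x⟩
  · rintro ⟨k, x⟩ ⟨l, y⟩ ⟨h, hxy⟩
    obtain rfl : k = l := h
    exact ⟨rfl, ((iter_laws G U B hB k).1 i).symm hxy⟩
  · rintro ⟨k, x⟩ ⟨l, y⟩ ⟨m, z⟩ ⟨h, hxy⟩ ⟨h', hyz⟩
    obtain rfl : k = l := h
    obtain rfl : k = m := h'
    exact ⟨rfl, ((iter_laws G U B hB k).1 i).trans hxy hyz⟩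

theorem runModel_normal {pl : A → I} {pa : A → P} {G : GameData I A P S}
    (hG : IsGameStructure pl pa G) (U : ObsModel I A) (B : BEpi I A P S)
    (hB : IsEpiModel G B.M) : Normal pl pa U (runModel G U B) := by
  obtain ⟨-, hturn, hinfo⟩ := hG
  refine ⟨?_, ?_, ?_, ?_, ?_, ?_⟩
  · rintro i a b ⟨k, x⟩ ⟨l, y⟩ t t' ⟨h, hxy⟩ ⟨_, rfl⟩ ⟨_, rfl⟩ hab hV
    obtain rfl : k = l := h
    exact ⟨rfl, hxy, hab, hV⟩
  · rintro i a ⟨k, x⟩ t ⟨m, z⟩ ⟨_, rfl⟩ ⟨h, hz⟩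
    obtain rfl : k + 1 = m := h
    exact ⟨⟨k, z.val.1⟩, z.val.2, ⟨rfl, hz.1⟩, hz.2.1, z.prop, rfl⟩
  · rintro a s t t' ⟨_, rfl⟩ ⟨_, rfl⟩
    rfl
  · rintro s ⟨a, _, ha, _⟩
    exact ⟨pl a, fun b ⟨_, hb, _⟩ => hturn _ b a hb ha⟩
  · rintro ⟨k, x⟩ a
    have hV : (runModel G U B).V ⟨k, x⟩ (pl a) = G.O ((iter G U B k).M.f x) (pl a) :=
      (iter_laws G U B hB k).2.2 x _
    rw [hV, hinfo]
    exact ⟨fun h => ⟨_, h, rfl⟩, fun ⟨_, h, _⟩ => h⟩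
  · rintro i ⟨k, x⟩ ⟨l, y⟩ ⟨h, hxy⟩
    obtain rfl : k = l := h
    obtain ⟨-, hO, hV⟩ := iter_laws G U B hB k
    exact (hV x i).trans ((hO i x y hxy).trans (hV y i).symm)

/-- Truth in the run model agrees with the dynamic semantics on each level. -/
theorem etlSat_runModel_iff (G : GameData I A P S) (U : ObsModel I A) (B : BEpi I A P S)
    (φ : LDEL I A P) :
    ∀ (k : ℕ) (w : (iter G U B k).W),
      etlSat (runModel G U B) φ ⟨k, w⟩ ↔ dynSat G U φ (iter G U B k).W (iter G U B k).M w := by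
  induction φ with
  | top => exact fun _ _ => Iff.rfl
  | atom p i => exact fun _ _ => Iff.rfl
  | neg φ ih => exact fun k w => not_congr (ih k w)
  | conj φ ψ ih₁ ih₂ => exact fun k w => and_congr (ih₁ k w) (ih₂ k w)
  | know i φ ih =>
    intro k w
    constructor
    · exact fun h v hv => (ih k v).1 (h ⟨k, v⟩ ⟨rfl, hv⟩)
    · rintro h ⟨l, v⟩ ⟨hl, hv⟩
      obtain rfl : k = l := hl
      exact (ih k v).2 (h v hv)
  | box a φ ih =>
    intro k w
    constructor
    · exact fun h hs => (ih (k + 1) (stepUp G U B k w a hs)).1 (h _ ⟨hs, rfl⟩)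
    · rintro h _ ⟨hs, rfl⟩
      exact (ih (k + 1) (stepUp G U B k w a hs)).2 (h hs)

theorem statement12 [Fintype I] [Fintype A] [Fintype P] [Nonempty I] [Nonempty A]
    (pl : A → I) (pa : A → P) (U : ObsModel I A) (φ : LDEL I A P) :
    (∀ (S : Type) (G : GameData I A P S), IsGameStructure pl pa G →
        ∀ (W : Type) (M : EpiData I A P S W), IsEpiModel G M →
          ∀ w : W, dynSat G U φ W M w) ↔
    (∀ (W : Type) (N : ETLData I A P W), IsETL N → Normal pl pa U N →
        ∀ w : W, etlSat N φ w) := by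
  constructor
  · intro h W N hE hN w
    refine (dynSat_inducedGame_iff hN φ W (epiPart N) (fun _ _ _ hs => hs)
      (fun _ _ s hs => ⟨s, rfl, hs⟩) (fun _ _ => rfl) w).1 ?_
    exact h W (inducedGame N) (inducedGame_isGameStructure hE hN) W (epiPart N)
      ⟨hE.1, hE.2, hN.2.2.2.2.2, fun _ _ => rfl⟩ w
  · intro h S G hG W M hM w
    exact (etlSat_runModel_iff G U ⟨W, M⟩ φ 0 w).1
      (h _ _ (runModel_isETL G U ⟨W, M⟩ hM) (runModel_normal hG U ⟨W, M⟩ hM) ⟨0, w⟩)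

end Statements
end GameRuns
end

section
/- (Soundness of SIG) Every theorem of the proof system SIG is valid under the dynamic semantics: if ⊢_SIG φ then M, w ⊨ φ for every game structure G, every epistemic model M with respect to G and every world w of M. -/
namespace GameRuns

variable {I A P S : Type}

section Soundness
variable {I A P S W : Type} {G : GameData I A P S} {U : ObsModel I A} {M : EpiData I A P S W}
  {w : W}

theorem dynSat_impF {φ ψ : LDEL I A P} :
    dynSat G U (impF φ ψ) W M w ↔ (dynSat G U φ W M w → dynSat G U ψ W M w) := by
  simp [impF, dynSat]

theorem dynSat_diaF {a : A} {φ : LDEL I A P} :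
    dynSat G U (diaF a φ) W M w ↔ ∃ h : (G.R (M.f w) a).isSome,
      dynSat G U φ (UpdW G M) (update G U M) ⟨(w, a), h⟩ := by
  simp [diaF, dynSat]

theorem dynSat_khatF {i : I} {φ : LDEL I A P} :
    dynSat G U (khatF i φ) W M w ↔ ∃ v, M.sim i w v ∧ dynSat G U φ W M v := by
  simp [khatF, dynSat]

theorem dynSat_bigAnd {l : List (LDEL I A P)} :
    dynSat G U (bigAnd l) W M w ↔ ∀ φ ∈ l, dynSat G U φ W M w := by
  induction l with
  | nil => simp [bigAnd, dynSat]
  | cons φ l ih => simp [bigAnd, dynSat, ih]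

theorem dynSat_bigOr {l : List (LDEL I A P)} :
    dynSat G U (bigOr l) W M w ↔ ∃ φ ∈ l, dynSat G U φ W M w := by
  induction l with
  | nil => simp [bigOr, dynSat]
  | cons φ l ih => simp [bigOr, orF, dynSat, ih, imp_iff_not_or]

theorem dynSat_turnF {l : List A} :
    dynSat G U (turnF l) W M w ↔ ∃ a ∈ l, (G.R (M.f w) a).isSome := by
  simp [turnF, dynSat_bigOr, dynSat_diaF, dynSat]

/-- The characteristic formula of `B` holds exactly where player `i` has information `B`. -/
theorem dynSat_charF {i : I} {B : Set P} {L1 L2 : List P} (h1 : ∀ p, p ∈ L1 ↔ p ∈ B)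
    (h2 : ∀ p, p ∈ L2 ↔ p ∉ B) : dynSat G U (charF i L1 L2) W M w ↔ M.V w i = B := by
  simp only [charF, dynSat, dynSat_bigAnd, List.forall_mem_map, h1, h2, Set.ext_iff]
  exact ⟨fun h p => ⟨fun hp => by_contra fun hB => h.2 p hB hp, h.1 p⟩,
    fun h => ⟨fun p => (h p).2, fun p hB hp => hB ((h p).1 hp)⟩⟩

theorem propEval_dynSat (φ : LDEL I A P) :
    propEval (fun ψ => dynSat G U ψ W M w) φ ↔ dynSat G U φ W M w := by
  induction φ with
  | neg φ ih => simp only [propEval, dynSat, ih]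
  | conj φ ψ ih₁ ih₂ => simp only [propEval, dynSat, ih₁, ih₂]
  | _ => simp only [propEval, dynSat]

/-- The update product of an epistemic model is again an epistemic model, provided that
some action is executable. -/
theorem IsEpiModel.update (hM : IsEpiModel G M) (x : UpdW G M) :
    IsEpiModel G (update G U M) := by
  obtain ⟨-, hE, -, -⟩ := hM
  refine ⟨⟨x⟩, fun i => ⟨fun y => ?_, fun h => ?_, fun h h' => ?_⟩, fun i y z h => h.2.2,
    fun y i => rfl⟩
  · exact ⟨(hE i).refl _, (U.equiv i).refl _, rfl⟩
  · exact ⟨(hE i).symm h.1, (U.equiv i).symm h.2.1, h.2.2.symm⟩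
  · exact ⟨(hE i).trans h.1 h'.1, (U.equiv i).trans h.2.1 h'.2.1, h.2.2.trans h'.2.2⟩

end Soundness

section Statements
variable {I A P S W W' : Type}

theorem statement13 [Fintype I] [Fintype A] [Fintype P] [Nonempty I] [Nonempty A]
    (pl : A → I) (pa : A → P) (U : ObsModel I A) (φ : LDEL I A P)
    (hphi : SIG pl pa U φ) :
    ∀ (S : Type) (G : GameData I A P S), IsGameStructure pl pa G →
      ∀ (W : Type) (M : EpiData I A P S W), IsEpiModel G M →
        ∀ w : W, dynSat G U φ W M w := by
  intro S G hG
  obtain ⟨-, hturn, hinfo⟩ := hG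
  induction hphi with
  | taut h => exact fun W M _ w => (propEval_dynSat _).1 (h _)
  | distK i φ ψ =>
    intro W M _ w
    simp only [dynSat_impF, dynSat]
    exact fun h h' v hv => h v hv (h' v hv)
  | distB a φ ψ =>
    intro W M _ w
    simp only [dynSat_impF, dynSat]
    exact fun h h' hs => h hs (h' hs)
  | axT i φ =>
    intro W M hM w
    simp only [dynSat_impF, dynSat]
    exact fun h => h w ((hM.2.1 i).refl w)
  | ax4 i φ =>
    intro W M hM w
    simp only [dynSat_impF, dynSat]
    exact fun h v hv u hu => h u ((hM.2.1 i).trans hv hu)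
  | ax5 i φ =>
    intro W M hM w
    simp only [dynSat_impF, dynSat]
    exact fun h v hv h' => h fun u hu => h' u ((hM.2.1 i).trans ((hM.2.1 i).symm hv) hu)
  | nm i a b φ B L1 L2 h1 h2 hab =>
    intro W M _ w
    simp only [dynSat_impF, dynSat_khatF, dynSat_diaF, dynSat, dynSat_charF h1 h2]
    rintro ⟨v, hv, hb, hφ, hB⟩ ha hB'
    exact ⟨⟨(v, b), hb⟩, ⟨hv, hab, hB'.trans hB.symm⟩, hφ⟩
  | pr i a φ L hL =>
    intro W M _ w
    simp only [dynSat_impF, dynSat_bigOr, List.mem_map, exists_exists_and_eq_and,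
      dynSat_khatF, dynSat_diaF]
    rintro ⟨ha, ⟨⟨v, b⟩, hb⟩, hsim, hφ⟩
    exact ⟨b, (hL b).2 hsim.2.1, v, hsim.1, hb, hφ⟩
  | det a φ =>
    intro W M _ w
    simp only [dynSat_impF, dynSat_diaF, dynSat]
    exact fun ⟨_, h⟩ _ => h
  | exturn i LA hLA LI hLI =>
    intro W M _ w
    simp only [dynSat_impF, dynSat_bigAnd, List.forall_mem_map, dynSat, dynSat_turnF, hLA, hLI]
    rintro ⟨a, rfl, ha⟩ _ hj ⟨b, rfl, hb⟩
    exact hj (hturn _ _ _ hb ha)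
  | info a =>
    intro W M hM w
    simp only [iffF, dynSat, dynSat_impF, dynSat_diaF, exists_prop, and_true, hM.2.2.2, hinfo]
    exact ⟨id, id⟩
  | ke p i =>
    intro W M hM w
    have hV : ∀ v, M.sim i w v → M.V w i = M.V v i := fun v hv => by
      rw [hM.2.2.2, hM.2.2.2, hM.2.2.1 i w v hv]
    simp only [dynSat, dynSat_impF]
    exact ⟨fun h v hv => hV v hv ▸ h, fun h v hv => hV v hv ▸ h⟩
  | mp _ _ ih ih' => exact fun W M hM w => dynSat_impF.1 (ih W M hM w) (ih' W M hM w)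
  | necK i _ ih => exact fun W M hM w v _ => ih W M hM v
  | necB a _ ih => exact fun W M hM w h => ih _ _ (hM.update ⟨(w, a), h⟩) _

end Statements
end GameRuns
end
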